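/- arXiv:1602.04294 — 8 statements merged into one kernel-verified Lean document; each statement's English description precedes it below -/
import Mathlib

section
/- For all TWTL formulas φ1, φ2, φ3 over AP, the formulas (φ1 · φ2) · φ3 and φ1 · (φ2 · φ3) are equivalent, i.e., for every finite word o over 2^AP and all 0 ≤ t1 ≤ t2 < |o|, o_{t1,t2} ⊨ (φ1 · φ2) · φ3 if and only if o_{t1,t2} ⊨ φ1 · (φ2 · φ3). -/
/-- TWTL formulas over a set `AP` of atomic propositions.
`hold d s` is `H^d s` where `s : Option AP` (`none` encodes `⊤`),
`holdNot d s` is `H^d ¬s`, and `within φ a b` is `[φ]^[a,b]`. -/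
inductive TWTL (AP : Type) : Type
  | hold    : ℕ → Option AP → TWTL AP
  | holdNot : ℕ → Option AP → TWTL AP
  | and     : TWTL AP → TWTL AP → TWTL AP
  | or      : TWTL AP → TWTL AP → TWTL AP
  | not     : TWTL AP → TWTL AP
  | concat  : TWTL AP → TWTL AP → TWTL AP
  | within  : TWTL AP → ℕ → ℕ → TWTL AP

namespace TWTL

variable {AP : Type}

/-- Satisfaction of an atom (`none` is `⊤`, identically true). -/
def atomSat (σ : Set AP) : Option AP → Prop
  | none => True
  | some p => p ∈ σ

/-- Satisfaction `o_{t1,t2} ⊨ φ` for a finite word `o` over `2^AP`. -/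
def Sat (o : List (Set AP)) : TWTL AP → ℕ → ℕ → Prop
  | .hold d s, t1, t2 =>
      (∀ t, t1 ≤ t → t ≤ t1 + d → atomSat (o.getD t ∅) s) ∧ d ≤ t2 - t1
  | .holdNot d s, t1, t2 =>
      (∀ t, t1 ≤ t → t ≤ t1 + d → ¬ atomSat (o.getD t ∅) s) ∧ d ≤ t2 - t1
  | .and φ1 φ2, t1, t2 => Sat o φ1 t1 t2 ∧ Sat o φ2 t1 t2
  | .or φ1 φ2, t1, t2 => Sat o φ1 t1 t2 ∨ Sat o φ2 t1 t2
  | .not φ1, t1, t2 => ¬ Sat o φ1 t1 t2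
  | .concat φ1 φ2, t1, t2 =>
      {t : ℕ | t1 ≤ t ∧ t < t2 ∧ Sat o φ1 t1 t}.Nonempty ∧
      Sat o φ2 (sInf {t : ℕ | t1 ≤ t ∧ t < t2 ∧ Sat o φ1 t1 t} + 1) t2
  | .within φ1 a b, t1, t2 =>
      b ≤ t2 - t1 ∧ ∃ t, t1 + a ≤ t ∧ t ≤ t1 + b ∧ Sat o φ1 t (t1 + b)

/-- Equivalence of TWTL formulas: same satisfaction on every finite word and
every pair of indices `t1 ≤ t2 < |o|`. -/
def Equiv (φ ψ : TWTL AP) : Prop :=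
  ∀ (o : List (Set AP)) (t1 t2 : ℕ), t1 ≤ t2 → t2 < o.length →
    (Sat o φ t1 t2 ↔ Sat o ψ t1 t2)

/-- Negation-normal: the general negation constructor does not occur. -/
def NegNormal : TWTL AP → Prop
  | .hold _ _ => True
  | .holdNot _ _ => True
  | .and φ1 φ2 => NegNormal φ1 ∧ NegNormal φ2
  | .or φ1 φ2 => NegNormal φ1 ∧ NegNormal φ2
  | .not _ => False
  | .concat φ1 φ2 => NegNormal φ1 ∧ NegNormal φ2
  | .within φ1 _ _ => NegNormal φ1

end TWTL

namespace TWTL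

theorem sat_concat_iff {AP : Type} (o : List (Set AP)) (φ ψ : TWTL AP) (t1 t2 : ℕ) :
    Sat o (.concat φ ψ) t1 t2 ↔
      ∃ m, IsLeast {t | t1 ≤ t ∧ Sat o φ t1 t} m ∧ m < t2 ∧ Sat o ψ (m + 1) t2 := by
  rw [Sat]
  constructor
  · rintro ⟨hne, hψ⟩
    obtain ⟨h1, h2, h3⟩ := Nat.sInf_mem hne
    refine ⟨_, ⟨⟨h1, h3⟩, fun k hk => ?_⟩, h2, hψ⟩
    by_contra! hlt
    exact Nat.notMem_of_lt_sInf hlt ⟨hk.1, hlt.trans h2, hk.2⟩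
  · rintro ⟨m, hm, hlt, hψ⟩
    have hm' : IsLeast {t | t1 ≤ t ∧ t < t2 ∧ Sat o φ t1 t} m :=
      ⟨⟨hm.1.1, hlt, hm.1.2⟩, fun k hk => hm.2 ⟨hk.1, hk.2.2⟩⟩
    exact ⟨hm'.nonempty, by rwa [hm'.csInf_eq]⟩

theorem isLeast_sat_concat_iff {AP : Type} (o : List (Set AP)) (φ ψ : TWTL AP) (t1 m : ℕ) :
    IsLeast {t | t1 ≤ t ∧ Sat o (.concat φ ψ) t1 t} m ↔
      ∃ j, IsLeast {t | t1 ≤ t ∧ Sat o φ t1 t} j ∧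
        IsLeast {t | j + 1 ≤ t ∧ Sat o ψ (j + 1) t} m := by
  simp only [sat_concat_iff]
  constructor
  · rintro ⟨⟨-, j, hj, hjm, hψ⟩, hmin⟩
    exact ⟨j, hj, ⟨hjm, hψ⟩, fun k hk =>
      hmin ⟨hj.1.1.trans (Nat.le_of_succ_le hk.1), j, hj, hk.1, hk.2⟩⟩
  · rintro ⟨j, hj, ⟨hjm, hψ⟩, hmin⟩
    refine ⟨⟨hj.1.1.trans (Nat.le_of_succ_le hjm), j, hj, hjm, hψ⟩, ?_⟩
    rintro k ⟨-, i, hi, hik, hk⟩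
    obtain rfl := hi.unique hj
    exact hmin ⟨hik, hk⟩

end TWTL

theorem concat_assoc {AP : Type} [Fintype AP] (φ1 φ2 φ3 : TWTL AP) :
    TWTL.Equiv (TWTL.concat (TWTL.concat φ1 φ2) φ3)
      (TWTL.concat φ1 (TWTL.concat φ2 φ3)) := by
  intro o t1 t2 _ _
  rw [TWTL.sat_concat_iff, TWTL.sat_concat_iff]
  simp only [TWTL.isLeast_sat_concat_iff]
  simp only [TWTL.sat_concat_iff]
  constructor
  · rintro ⟨m, ⟨j, hj, hm⟩, hmt, h3⟩
    exact ⟨j, hj, (Nat.lt_of_succ_le hm.1.1).trans hmt, m, hm, hmt, h3⟩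
  · rintro ⟨j, hj, -, m, hm, hmt, h3⟩
    exact ⟨m, ⟨j, hj, hm⟩, hmt, h3⟩
end

section
/- Let s ∈ AP and d ∈ ℕ. For every finite word o over 2^AP and all 0 ≤ t1 ≤ t2 < |o| with t2 − t1 ≥ d: o_{t1,t2} ⊨ ¬(H^d s) if and only if o_{t1,t2} ⊨ [H^0 ¬s]^[0,d], and o_{t1,t2} ⊨ ¬(H^d ¬s) if and only if o_{t1,t2} ⊨ [H^0 s]^[0,d]. -/
theorem not_hold_eq_within {AP : Type} [Fintype AP] (s : AP) (d : ℕ) :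
    ∀ (o : List (Set AP)) (t1 t2 : ℕ), t1 ≤ t2 → t2 < o.length → d ≤ t2 - t1 →
      (TWTL.Sat o (TWTL.not (TWTL.hold d (some s))) t1 t2 ↔
        TWTL.Sat o (TWTL.within (TWTL.holdNot 0 (some s)) 0 d) t1 t2) ∧
      (TWTL.Sat o (TWTL.not (TWTL.holdNot d (some s))) t1 t2 ↔
        TWTL.Sat o (TWTL.within (TWTL.hold 0 (some s)) 0 d) t1 t2) := by
  intro o t1 t2 _ _ hd
  simp only [TWTL.Sat, Nat.add_zero, Nat.zero_le, and_true, hd, true_and]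
  constructor
  · constructor
    · intro h
      push Not at h
      obtain ⟨t, h1, h2, h3⟩ := h
      refine ⟨t, h1, h2, fun u hu hu' => ?_⟩
      rwa [le_antisymm hu' hu]
    · rintro ⟨t, h1, h2, h3⟩ h
      exact h3 t le_rfl le_rfl (h t h1 h2)
  · constructor
    · intro h
      push Not at h
      obtain ⟨t, h1, h2, h3⟩ := h
      refine ⟨t, h1, h2, fun u hu hu' => ?_⟩
      rwa [le_antisymm hu' hu]
    · rintro ⟨t, h1, h2, h3⟩ h
      exact h t h1 h2 (h3 t le_rfl le_rfl)
end

section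
/- Let φ1 be a TWTL formula over AP and let a1, b1 be naturals with 1 ≤ a1 ≤ b1. Then the formulas [φ1]^[a1,b1] and (H^{a1−1} ⊤) · [φ1]^[0, b1−a1] are equivalent. -/
/-- `H^d ⊤` consumes exactly `d + 1` letters when concatenated with a formula. -/
theorem TWTL.sat_concat_hold_top {AP : Type} (o : List (Set AP)) (φ : TWTL AP) (d t1 t2 : ℕ) :
    TWTL.Sat o (TWTL.concat (TWTL.hold d none) φ) t1 t2 ↔
      t1 + d < t2 ∧ TWTL.Sat o φ (t1 + d + 1) t2 := by
  have hset : {t : ℕ | t1 ≤ t ∧ t < t2 ∧ TWTL.Sat o (TWTL.hold d none) t1 t} =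
      Set.Ico (t1 + d) t2 := by
    ext t
    simp only [TWTL.Sat, TWTL.atomSat, implies_true, true_and, Set.mem_ofPred_eq, Set.mem_Ico]
    omega
  rw [TWTL.Sat, hset, Set.nonempty_Ico]
  refine and_congr_right fun h => ?_
  rw [csInf_Ico h]

theorem within_shift {AP : Type} [Fintype AP] (φ1 : TWTL AP)
    (a1 b1 : ℕ) (ha : 1 ≤ a1) (hab : a1 ≤ b1) :
    TWTL.Equiv (TWTL.within φ1 a1 b1)
      (TWTL.concat (TWTL.hold (a1 - 1) none) (TWTL.within φ1 0 (b1 - a1))) := by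
  intro o t1 t2 _ _
  have hstart : t1 + (a1 - 1) + 1 = t1 + a1 := by omega
  have hend : t1 + a1 + (b1 - a1) = t1 + b1 := by omega
  rw [TWTL.sat_concat_hold_top, hstart, TWTL.Sat, TWTL.Sat, hend, add_zero, ← and_assoc]
  refine and_congr_left fun _ => ?_
  omega
end

section
/- Let s ∈ AP ∪ {⊤}, let p be either s or ¬s, and let d1, d2 ∈ ℕ. Then the formulas (H^{d1} p) · (H^{d2} p) and H^{d1+d2+1} p are equivalent. -/
/-- Two consecutive windows on which `P` holds, the first one chosen to end as early as possible,
amount to a single window on which `P` holds. -/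
theorem concat_window_iff (P : ℕ → Prop) (d1 d2 t1 t2 : ℕ) :
    ({t : ℕ | t1 ≤ t ∧ t < t2 ∧ (∀ u, t1 ≤ u → u ≤ t1 + d1 → P u) ∧ d1 ≤ t - t1}.Nonempty ∧
      (∀ u, sInf {t : ℕ | t1 ≤ t ∧ t < t2 ∧ (∀ u, t1 ≤ u → u ≤ t1 + d1 → P u) ∧
          d1 ≤ t - t1} + 1 ≤ u →
        u ≤ sInf {t : ℕ | t1 ≤ t ∧ t < t2 ∧ (∀ u, t1 ≤ u → u ≤ t1 + d1 → P u) ∧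
          d1 ≤ t - t1} + 1 + d2 → P u) ∧
      d2 ≤ t2 - (sInf {t : ℕ | t1 ≤ t ∧ t < t2 ∧ (∀ u, t1 ≤ u → u ≤ t1 + d1 → P u) ∧
          d1 ≤ t - t1} + 1)) ↔
    (∀ u, t1 ≤ u → u ≤ t1 + (d1 + d2 + 1) → P u) ∧ d1 + d2 + 1 ≤ t2 - t1 := by
  set S := {t : ℕ | t1 ≤ t ∧ t < t2 ∧ (∀ u, t1 ≤ u → u ≤ t1 + d1 → P u) ∧ d1 ≤ t - t1}
  have isLeast (hlt : t1 + d1 < t2) (hP : ∀ u, t1 ≤ u → u ≤ t1 + d1 → P u) :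
      IsLeast S (t1 + d1) :=
    ⟨⟨by omega, hlt, hP, by omega⟩, fun t ⟨_, _, _, _⟩ => by omega⟩
  constructor
  · rintro ⟨⟨t, ht1, ht2, hP, hd⟩, hQ, hd2⟩
    rw [(isLeast (by omega) hP).csInf_eq] at hQ hd2
    refine ⟨fun u hu hu' => ?_, by omega⟩
    rcases le_or_gt u (t1 + d1) with hle | hgt
    · exact hP u hu hle
    · exact hQ u (by omega) (by omega)
  · rintro ⟨hP, hd⟩
    have hleast := isLeast (by omega) fun u hu hu' => hP u hu (by omega)
    rw [hleast.csInf_eq]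
    exact ⟨hleast.nonempty, fun u hu hu' => hP u (by omega) (by omega), by omega⟩

theorem hold_concat_hold {AP : Type} [Fintype AP] (s : Option AP) (d1 d2 : ℕ) :
    TWTL.Equiv (TWTL.concat (TWTL.hold d1 s) (TWTL.hold d2 s))
      (TWTL.hold (d1 + d2 + 1) s) ∧
    TWTL.Equiv (TWTL.concat (TWTL.holdNot d1 s) (TWTL.holdNot d2 s))
      (TWTL.holdNot (d1 + d2 + 1) s) := by
  constructor <;> intro o t1 t2 _ _ <;> simp only [TWTL.Sat]
  · exact concat_window_iff (fun u => TWTL.atomSat (o.getD u ∅) s) d1 d2 t1 t2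
  · exact concat_window_iff (fun u => ¬ TWTL.atomSat (o.getD u ∅) s) d1 d2 t1 t2
end

section
/- (Right-extension monotonicity.) Let φ be a negation-normal TWTL formula over AP. For every finite word o over 2^AP and all indices 0 ≤ t1 ≤ t2 ≤ t2' < |o|: if o_{t1,t2} ⊨ φ, then o_{t1,t2'} ⊨ φ. -/
/-- Raising an upper cutoff on a set of naturals that already has an element below the
cutoff does not change its minimum. -/
theorem Nat.sInf_lt_cutoff_eq {P : ℕ → Prop} {a b c : ℕ} (hbc : b ≤ c)
    (h : {t : ℕ | a ≤ t ∧ t < b ∧ P t}.Nonempty) :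
    sInf {t : ℕ | a ≤ t ∧ t < c ∧ P t} = sInf {t : ℕ | a ≤ t ∧ t < b ∧ P t} := by
  have hsub : {t : ℕ | a ≤ t ∧ t < b ∧ P t} ⊆ {t : ℕ | a ≤ t ∧ t < c ∧ P t} :=
    fun t ht => ⟨ht.1, ht.2.1.trans_le hbc, ht.2.2⟩
  have hle := Nat.sInf_le (hsub (Nat.sInf_mem h))
  have hmem := Nat.sInf_mem (h.mono hsub)
  exact le_antisymm hle
    (Nat.sInf_le ⟨hmem.1, hle.trans_lt (Nat.sInf_mem h).2.1, hmem.2.2⟩)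

theorem sat_mono_right {AP : Type} [Fintype AP] (φ : TWTL AP)
    (hnn : TWTL.NegNormal φ) :
    ∀ (o : List (Set AP)) (t1 t2 t2' : ℕ), t1 ≤ t2 → t2 ≤ t2' → t2' < o.length →
      TWTL.Sat o φ t1 t2 → TWTL.Sat o φ t1 t2' := by
  intro o
  induction φ with
  | hold d s => exact fun t1 t2 t2' _ h _ hs => ⟨hs.1, hs.2.trans (Nat.sub_le_sub_right h t1)⟩
  | holdNot d s => exact fun t1 t2 t2' _ h _ hs => ⟨hs.1, hs.2.trans (Nat.sub_le_sub_right h t1)⟩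
  | and φ1 φ2 ih1 ih2 =>
    exact fun t1 t2 t2' h1 h2 h3 hs =>
      ⟨ih1 hnn.1 t1 t2 t2' h1 h2 h3 hs.1, ih2 hnn.2 t1 t2 t2' h1 h2 h3 hs.2⟩
  | or φ1 φ2 ih1 ih2 =>
    exact fun t1 t2 t2' h1 h2 h3 hs =>
      hs.imp (ih1 hnn.1 t1 t2 t2' h1 h2 h3) (ih2 hnn.2 t1 t2 t2' h1 h2 h3)
  | not φ1 _ => exact hnn.elim
  | concat φ1 φ2 _ ih2 =>
    rintro t1 t2 t2' - h2 h3 ⟨hne, hs⟩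
    refine ⟨hne.mono fun t ht => ⟨ht.1, ht.2.1.trans_le h2, ht.2.2⟩, ?_⟩
    rw [Nat.sInf_lt_cutoff_eq h2 hne]
    exact ih2 hnn.2 _ t2 t2' (Nat.sInf_mem hne).2.1 h2 h3 hs
  | within φ1 a b _ =>
    exact fun t1 t2 t2' _ h _ hs => ⟨hs.1.trans (Nat.sub_le_sub_right h t1), hs.2⟩
end

section
/- Let φ1 be a negation-normal TWTL formula over AP, let a ≤ b be naturals, and let τ ∈ ℕ. For every finite word o over 2^AP and all 0 ≤ t1 ≤ t2 < |o| with t2 − t1 ≥ b + τ: if o_{t1,t2} ⊨ [φ1]^[a,b], then o_{t1,t2} ⊨ [φ1]^[a, b+τ]. -/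
namespace TWTL

/-- Restricting a set of naturals to an initial segment that it meets does not change its
infimum. -/
theorem sInf_lt_eq_of_le {p : ℕ → Prop} {t1 t2 t2' : ℕ} (h : t2 ≤ t2')
    (hne : {t : ℕ | t1 ≤ t ∧ t < t2 ∧ p t}.Nonempty) :
    sInf {t : ℕ | t1 ≤ t ∧ t < t2' ∧ p t} = sInf {t : ℕ | t1 ≤ t ∧ t < t2 ∧ p t} := by
  obtain ⟨h1, h2, h3⟩ := Nat.sInf_mem hne
  have hmem : sInf {t : ℕ | t1 ≤ t ∧ t < t2 ∧ p t} ∈ {t : ℕ | t1 ≤ t ∧ t < t2' ∧ p t} :=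
    ⟨h1, h2.trans_le h, h3⟩
  have hle := Nat.sInf_le hmem
  obtain ⟨k1, -, k3⟩ := Nat.sInf_mem ⟨_, hmem⟩
  exact le_antisymm hle (Nat.sInf_le ⟨k1, hle.trans_lt h2, k3⟩)

/-- Satisfaction of a negation-normal formula is monotone in the right end point. -/
theorem NegNormal.sat_mono {AP : Type} {o : List (Set AP)} {φ : TWTL AP} (hφ : φ.NegNormal)
    {t1 t2 t2' : ℕ} (h : t2 ≤ t2') (hs : Sat o φ t1 t2) : Sat o φ t1 t2' := by
  induction φ generalizing t1 t2 t2' with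
  | hold d s => exact ⟨hs.1, hs.2.trans (Nat.sub_le_sub_right h t1)⟩
  | holdNot d s => exact ⟨hs.1, hs.2.trans (Nat.sub_le_sub_right h t1)⟩
  | and φ1 φ2 ih1 ih2 => exact ⟨ih1 hφ.1 h hs.1, ih2 hφ.2 h hs.2⟩
  | or φ1 φ2 ih1 ih2 => exact hs.imp (ih1 hφ.1 h) (ih2 hφ.2 h)
  | not φ1 => exact hφ.elim
  | concat φ1 φ2 ih1 ih2 =>
    obtain ⟨hne, hs2⟩ := hs
    refine ⟨hne.mono fun t ht => ⟨ht.1, ht.2.1.trans_le h, ht.2.2⟩, ?_⟩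
    rw [sInf_lt_eq_of_le h hne]
    exact ih2 hφ.2 h hs2
  | within φ1 a b => exact ⟨hs.1.trans (Nat.sub_le_sub_right h t1), hs.2⟩

end TWTL

theorem within_relax_deadline {AP : Type} [Fintype AP] (φ1 : TWTL AP)
    (hnn : TWTL.NegNormal φ1) (a b τ : ℕ) (hab : a ≤ b) :
    ∀ (o : List (Set AP)) (t1 t2 : ℕ), t1 ≤ t2 → t2 < o.length → b + τ ≤ t2 - t1 →
      TWTL.Sat o (TWTL.within φ1 a b) t1 t2 →
      TWTL.Sat o (TWTL.within φ1 a (b + τ)) t1 t2 := by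
  rintro o t1 t2 - - hb ⟨-, t, hat, htb, hs⟩
  exact ⟨hb, t, hat, by omega, hnn.sat_mono (by omega) hs⟩
end

section
/- Let Σ be a finite alphabet and let L1, L2 be languages of nonempty finite words over Σ with L2 ≠ ∅. Then the concatenation L1 · L2 is unambiguous (i.e., the sets L1⁻, L1, and L1 · (P(L2) \ {ε}) are pairwise disjoint with union P(L1 · L2)) if and only if L1 is an unambiguous language. -/
/-- `w` is a (nonempty) prefix of `w'`: `w = w'_{0,i}` for some `0 ≤ i < |w'|`. -/
def IsPrefixWord {α : Type} (w w' : List α) : Prop :=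
  ∃ i, i < w'.length ∧ w = w'.take (i + 1)

/-- `w` is a proper prefix of `w'`. -/
def IsProperPrefixWord {α : Type} (w w' : List α) : Prop :=
  IsPrefixWord w w' ∧ w ≠ w'

/-- `L1` is a prefix language of `L2`: every word of `L1` is a prefix of some word of `L2`. -/
def PrefixLang {α : Type} (L1 L2 : Set (List α)) : Prop :=
  ∀ w ∈ L1, ∃ w' ∈ L2, IsPrefixWord w w'

/-- `L` is unambiguous: no nonempty proper subset `L'` of `L` is a prefix
language of `L \ L'`. -/
def Unambiguous {α : Type} (L : Set (List α)) : Prop :=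
  ∀ L' : Set (List α), L' ⊂ L → L'.Nonempty → ¬ PrefixLang L' (L \ L')

/-- The maximal prefix language `P(L)`. -/
def maxPrefixLang {α : Type} (L : Set (List α)) : Set (List α) :=
  {p | ∃ w ∈ L, IsPrefixWord p w}

/-- Concatenation of languages. -/
def concatLang {α : Type} (L1 L2 : Set (List α)) : Set (List α) :=
  {w | ∃ u ∈ L1, ∃ v ∈ L2, w = u ++ v}

/-- `L1⁻ = { w_{0,i} : w ∈ L1, 0 ≤ i ≤ |w| - 2 }`, the proper prefixes of words of `L1`. -/
def properPrefixesLang {α : Type} (L1 : Set (List α)) : Set (List α) :=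
  {p | ∃ w ∈ L1, ∃ i, i + 2 ≤ w.length ∧ p = w.take (i + 1)}

theorem isPrefixWord_iff {α : Type} {p w : List α} :
    IsPrefixWord p w ↔ p ≠ [] ∧ p <+: w := by
  constructor
  · rintro ⟨i, hi, rfl⟩
    refine ⟨?_, List.take_prefix _ _⟩
    rw [← List.length_pos_iff, List.length_take]
    omega
  · rintro ⟨hp, hpw⟩
    have hpos := List.length_pos_iff.mpr hp
    have hle := hpw.length_le
    refine ⟨p.length - 1, by omega, ?_⟩
    rw [Nat.sub_add_cancel hpos]
    exact List.prefix_iff_eq_take.mp hpw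

theorem mem_properPrefixesLang {α : Type} {L : Set (List α)} {p : List α} :
    p ∈ properPrefixesLang L ↔ ∃ w ∈ L, p ≠ [] ∧ p <+: w ∧ p ≠ w := by
  constructor
  · rintro ⟨w, hw, i, hi, rfl⟩
    refine ⟨w, hw, ?_, List.take_prefix _ _, fun h => ?_⟩
    · rw [← List.length_pos_iff, List.length_take]
      omega
    · have := congrArg List.length h
      rw [List.length_take] at this
      omega
  · rintro ⟨w, hw, hp, hpw, hne⟩
    have hpos := List.length_pos_iff.mpr hp
    have hlt : p.length < w.length :=
      lt_of_le_of_ne hpw.length_le fun h => hne (hpw.eq_of_length h)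
    refine ⟨w, hw, p.length - 1, by omega, ?_⟩
    rw [Nat.sub_add_cancel hpos]
    exact List.prefix_iff_eq_take.mp hpw

theorem mem_maxPrefixLang {α : Type} {L : Set (List α)} {p : List α} :
    p ∈ maxPrefixLang L ↔ ∃ w ∈ L, p ≠ [] ∧ p <+: w := by
  simp only [maxPrefixLang, Set.mem_ofPred_eq, isPrefixWord_iff]

/-- For languages of nonempty words, unambiguous means prefix-free. -/
theorem unambiguous_iff_prefixFree {α : Type} {L : Set (List α)} (h : ∀ w ∈ L, w ≠ []) :
    Unambiguous L ↔ ∀ u ∈ L, ∀ w ∈ L, u <+: w → u = w := by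
  constructor
  · intro hL u hu w hw huw
    by_contra hne
    refine hL {u} ⟨Set.singleton_subset_iff.mpr hu, fun hs => hne (hs hw).symm⟩
      (Set.singleton_nonempty u) ?_
    rintro _ rfl
    exact ⟨w, ⟨hw, fun hwu => hne hwu.symm⟩, isPrefixWord_iff.mpr ⟨h _ hu, huw⟩⟩
  · rintro hL L' hL' ⟨u, hu⟩ hpre
    obtain ⟨w, ⟨hw, hwL'⟩, huw⟩ := hpre u hu
    exact hwL' (hL u (hL'.1 hu) w hw (isPrefixWord_iff.mp huw).2 ▸ hu)

/-- The prefixes of words of `L1 · L2` are covered by the three sets, ambiguous or not. -/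
theorem prefixes_union_eq_maxPrefixLang_concatLang {α : Type} {L1 L2 : Set (List α)}
    (h1 : ∀ w ∈ L1, w ≠ []) (hne : L2.Nonempty) :
    properPrefixesLang L1 ∪ L1 ∪ concatLang L1 (maxPrefixLang L2 \ {[]}) =
      maxPrefixLang (concatLang L1 L2) := by
  obtain ⟨v₀, hv₀⟩ := hne
  ext p
  rw [mem_maxPrefixLang]
  constructor
  · rintro ((hp | hp) | ⟨u, hu, v, ⟨hv, -⟩, rfl⟩)
    · obtain ⟨w, hw, hp, hpw, -⟩ := mem_properPrefixesLang.mp hp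
      exact ⟨w ++ v₀, ⟨w, hw, v₀, hv₀, rfl⟩, hp, hpw.trans (List.prefix_append _ _)⟩
    · exact ⟨p ++ v₀, ⟨p, hp, v₀, hv₀, rfl⟩, h1 p hp, List.prefix_append _ _⟩
    · obtain ⟨w, hw, -, hvw⟩ := mem_maxPrefixLang.mp hv
      exact ⟨u ++ w, ⟨u, hu, w, hw, rfl⟩, List.append_ne_nil_of_left_ne_nil (h1 u hu) _,
        (List.prefix_append_right_inj u).mpr hvw⟩
  · rintro ⟨_, ⟨u, hu, v, hv, rfl⟩, hp, hpuv⟩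
    by_cases hpu : p <+: u
    · left
      by_cases heq : p = u
      · exact Or.inr (heq ▸ hu)
      · exact Or.inl (mem_properPrefixesLang.mpr ⟨u, hu, hp, hpu, heq⟩)
    · right
      obtain ⟨t, rfl⟩ :=
        (List.prefix_or_prefix_of_prefix hpuv (List.prefix_append u v)).resolve_left hpu
      have ht : t ≠ [] := by
        rintro rfl
        simp at hpu
      exact ⟨u, hu, t, ⟨mem_maxPrefixLang.mpr
        ⟨v, hv, ht, (List.prefix_append_right_inj u).mp hpuv⟩, ht⟩, rfl⟩

theorem unambiguous_concat_iff {α : Type} [Fintype α] (L1 L2 : Set (List α))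
    (h1 : ∀ w ∈ L1, w ≠ []) (h2 : ∀ w ∈ L2, w ≠ []) (hne : L2.Nonempty) :
    (Disjoint (properPrefixesLang L1) L1 ∧
     Disjoint (properPrefixesLang L1) (concatLang L1 (maxPrefixLang L2 \ {[]})) ∧
     Disjoint L1 (concatLang L1 (maxPrefixLang L2 \ {[]})) ∧
     properPrefixesLang L1 ∪ L1 ∪ concatLang L1 (maxPrefixLang L2 \ {[]}) =
       maxPrefixLang (concatLang L1 L2)) ↔
    Unambiguous L1 := by
  rw [unambiguous_iff_prefixFree h1]
  constructor
  · rintro ⟨hd, -⟩ u hu w hw huw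
    by_contra hne'
    exact Set.disjoint_left.mp hd (mem_properPrefixesLang.mpr ⟨w, hw, h1 u hu, huw, hne'⟩) hu
  · intro hL
    have extension_free : ∀ u ∈ L1, ∀ v ∈ maxPrefixLang L2 \ {[]}, ∀ w ∈ L1,
        ¬ u ++ v <+: w := by
      intro u hu v hv w hw huv
      obtain rfl := hL u hu w hw ((List.prefix_append u v).trans huv)
      have hlen := huv.length_le
      rw [List.length_append] at hlen
      exact hv.2 (List.length_eq_zero_iff.mp (by omega))
    refine ⟨Set.disjoint_left.mpr ?_, Set.disjoint_left.mpr ?_, Set.disjoint_left.mpr ?_,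
      prefixes_union_eq_maxPrefixLang_concatLang h1 hne⟩
    · intro p hp hpL
      obtain ⟨w, hw, -, hpw, hpne⟩ := mem_properPrefixesLang.mp hp
      exact hpne (hL p hpL w hw hpw)
    · rintro _ hp ⟨u, hu, v, hv, rfl⟩
      obtain ⟨w, hw, -, hpw, -⟩ := mem_properPrefixesLang.mp hp
      exact extension_free u hu v hv w hw hpw
    · rintro _ hp ⟨u, hu, v, hv, rfl⟩
      exact extension_free u hu v hv _ hp List.prefix_rfl
end

section
/- Let A be a DFA over a finite alphabet Σ. The accepted language L(A) is finite if and only if there is no state s of A that is reachable, co-reachable, and lies on a nontrivial cycle, i.e., there do not exist a state s and a nonempty finite word x with s reachable, s co-reachable, and δ*(s, x) = s. -/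
theorem DFA.evalFrom_flatten_replicate {α σ : Type*} (A : DFA α σ) {s : σ} {x : List α}
    (hx : A.evalFrom s x = s) (n : ℕ) :
    A.evalFrom s (List.replicate n x).flatten = s := by
  induction n with
  | zero => simp
  | succ n ih => rw [List.replicate_succ, List.flatten_cons, DFA.evalFrom_of_append, hx, ih]

theorem accepts_finite_iff_no_useful_cycle {α σ : Type} [Fintype α] [Fintype σ]
    (A : DFA α σ) :
    Set.Finite {w : List α | w ∈ A.accepts} ↔
      ¬ ∃ (s : σ) (x : List α), x ≠ [] ∧
        (∃ w : List α, A.evalFrom A.start w = s) ∧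
        (∃ w : List α, A.evalFrom s w ∈ A.accept) ∧
        A.evalFrom s x = s := by
  constructor
  · rintro hfin ⟨s, x, hx, ⟨u, hu⟩, ⟨v, hv⟩, hs⟩
    refine Set.infinite_of_injective_forall_mem
      (f := fun n : ℕ => u ++ (List.replicate n x).flatten ++ v) ?_ ?_ hfin
    · intro m n hmn
      have hlen := congrArg List.length hmn
      simpa [hx] using hlen
    · intro n
      change A.evalFrom A.start _ ∈ A.accept
      rwa [DFA.evalFrom_of_append, DFA.evalFrom_of_append, hu,
        A.evalFrom_flatten_replicate hs]
  · intro hcycle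
    refine (List.finite_length_lt α (Fintype.card σ)).subset fun w hw => ?_
    by_contra hlen
    obtain ⟨q, a, b, c, -, -, hb, ha, hq, hc⟩ :=
      A.evalFrom_split (s := A.start) (not_lt.mp hlen) rfl
    exact hcycle ⟨q, b, hb, ⟨a, ha⟩, ⟨c, hc ▸ hw⟩, hq⟩
end
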